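/- arXiv:2205.06074 — 2 statements merged into one kernel-verified Lean document; each statement's English description precedes it below -/
import Mathlib

section
/- Let γ, ω, k ∈ ℝ, ε, ν₀, κ₀ ∈ ℝ and λ ∈ ℂ. Define the 4×4 complex matrix A with rows: row 1 = (−iω − εν₀(λ² − k²), 0, −sin γ, ik); row 2 = (0, −iω − εν₀(λ² − k²), −cos γ, −λ); row 3 = (sin γ, cos γ, −iω − εκ₀(λ² − k²), 0); row 4 = (ik, −λ, 0, 0). Then det A = P(λ), where P(λ) = −ε²κ₀ν₀λ⁶ + (−iεω(κ₀+ν₀) + 3ν₀κ₀ε²k²)λ⁴ + ((ω² − sin²γ) + 2iεω(κ₀+ν₀)k² − 3ν₀κ₀ε²k⁴)λ² − 2iλk·sin γ·cos γ + k²(cos²γ − ω² − iεω(ν₀+κ₀)k² + ν₀κ₀ε²k⁴). -/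
open Complex Real

/-- The determinant of the symbol matrix of the viscous/diffusive linearized
Boussinesq system (boundary-layer ansatz `e^{−iωt+ikx−λy}(U,W,B,P)`) equals the
characteristic polynomial `P(λ)`. -/
theorem stmt_3 (γ ω k ε ν₀ κ₀ : ℝ) (l : ℂ) :
    Matrix.det
      (!![-Complex.I * (ω : ℂ) - (ε : ℂ) * (ν₀ : ℂ) * (l ^ 2 - (k : ℂ) ^ 2), 0,
            -(Real.sin γ : ℂ), Complex.I * (k : ℂ);
          0, -Complex.I * (ω : ℂ) - (ε : ℂ) * (ν₀ : ℂ) * (l ^ 2 - (k : ℂ) ^ 2),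
            -(Real.cos γ : ℂ), -l;
          (Real.sin γ : ℂ), (Real.cos γ : ℂ),
            -Complex.I * (ω : ℂ) - (ε : ℂ) * (κ₀ : ℂ) * (l ^ 2 - (k : ℂ) ^ 2), 0;
          Complex.I * (k : ℂ), -l, 0, 0] : Matrix (Fin 4) (Fin 4) ℂ) =
      -(ε : ℂ) ^ 2 * (κ₀ : ℂ) * (ν₀ : ℂ) * l ^ 6
      + (-Complex.I * (ε : ℂ) * (ω : ℂ) * ((κ₀ : ℂ) + (ν₀ : ℂ))
          + 3 * (ν₀ : ℂ) * (κ₀ : ℂ) * (ε : ℂ) ^ 2 * (k : ℂ) ^ 2) * l ^ 4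
      + (((ω : ℂ) ^ 2 - (Real.sin γ : ℂ) ^ 2)
          + 2 * Complex.I * (ε : ℂ) * (ω : ℂ) * ((κ₀ : ℂ) + (ν₀ : ℂ)) * (k : ℂ) ^ 2
          - 3 * (ν₀ : ℂ) * (κ₀ : ℂ) * (ε : ℂ) ^ 2 * (k : ℂ) ^ 4) * l ^ 2
      - 2 * Complex.I * l * (k : ℂ) * (Real.sin γ : ℂ) * (Real.cos γ : ℂ)
      + (k : ℂ) ^ 2 * ((Real.cos γ : ℂ) ^ 2 - (ω : ℂ) ^ 2
          - Complex.I * (ε : ℂ) * (ω : ℂ) * ((ν₀ : ℂ) + (κ₀ : ℂ)) * (k : ℂ) ^ 2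
          + (ν₀ : ℂ) * (κ₀ : ℂ) * (ε : ℂ) ^ 2 * (k : ℂ) ^ 4) := by
  simp only [Matrix.det_succ_row_zero, Fin.sum_univ_succ, Fin.succAbove,
    Matrix.submatrix_apply]
  simp [Fin.lt_def]
  linear_combination (-(k : ℂ) ^ 2 *
      ((-Complex.I * ω - ε * ν₀ * (l ^ 2 - k ^ 2)) * (-Complex.I * ω - ε * κ₀ * (l ^ 2 - k ^ 2))
        + Complex.cos γ ^ 2) - (l ^ 2 - k ^ 2) * ω ^ 2) * Complex.I_sq
end

section
/- Let γ, ω, k ∈ ℝ with k ≠ 0, let ε, ν₀, κ₀ ∈ ℝ, and let λ ∈ ℂ with λ ≠ 0 and iω + εκ₀(λ² − k²) ≠ 0. Assume P(λ) = 0, where P is the characteristic polynomial P(λ) = −ε²κ₀ν₀λ⁶ + (−iεω(κ₀+ν₀) + 3ν₀κ₀ε²k²)λ⁴ + ((ω² − sin²γ) + 2iεω(κ₀+ν₀)k² − 3ν₀κ₀ε²k⁴)λ² − 2iλk·sin γ·cos γ + k²(cos²γ − ω² − iεω(ν₀+κ₀)k² + ν₀κ₀ε²k⁴). Then the vector (U,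 W, B, P₄) ∈ ℂ⁴ given by U = 1, W = ik/λ, B = (λ·sin γ + ik·cos γ)/(λ·(iω − εκ₀(k² − λ²))), P₄ = (1/(ik))·(iω + εν₀(λ² − k²) + sin γ·(sin γ + (ik/λ)·cos γ)/(iω + εκ₀(λ² − k²))) satisfies: (−iω − εν₀(λ² − k²))·U − sin γ·B + ik·P₄ = 0, (−iω − εν₀(λ² − k²))·W − cos γ·B − λ·P₄ = 0, (−iω − εκ₀(λ² − k²))·B + sin γ·U + cos γ·W = 0, and ik·U − λ·W = 0. -/
open Complex

/-- The symbol equations for abstract momentum and buoyancy symbols `N`, `K`: the determinant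
condition `(l² - k²) N K + (l s + i k c)² = 0` makes the explicit vector a kernel element. -/
theorem symbol_kernel {k l N K s c : ℂ} (hk : k ≠ 0) (hl : l ≠ 0) (hK : K ≠ 0)
    (h : (l ^ 2 - k ^ 2) * (N * K) + (l * s + I * k * c) ^ 2 = 0) :
    (-N * 1 - s * ((l * s + I * k * c) / (l * K))
      + I * k * (1 / (I * k) * (N + s * (s + I * k / l * c) / K)) = 0) ∧
    (-N * (I * k / l) - c * ((l * s + I * k * c) / (l * K))
      - l * (1 / (I * k) * (N + s * (s + I * k / l * c) / K)) = 0) ∧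
    (-K * ((l * s + I * k * c) / (l * K)) + s * 1 + c * (I * k / l) = 0) ∧
    (I * k * 1 - l * (I * k / l) = 0) := by
  have hI : I ≠ 0 := I_ne_zero
  refine ⟨by field_simp; ring, ?_, by field_simp; ring, by field_simp; ring⟩
  have key : -N * (I * k / l) - c * ((l * s + I * k * c) / (l * K))
      - l * (1 / (I * k) * (N + s * (s + I * k / l * c) / K))
      = -((l ^ 2 - k ^ 2) * (N * K) + (l * s + I * k * c) ^ 2) / (I * k * l * K) := by
    field_simp
    ring_nf
    simp only [I_sq]
    ring
  rw [key, h, neg_zero, zero_div]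

/-- The boundary-layer eigenvector `X_{k,λ}` lies in the kernel of the symbol of
the viscous/diffusive linearized Boussinesq system whenever `λ` is a root of the
characteristic polynomial `P`. -/
theorem stmt_6 (γ ω k ε ν₀ κ₀ : ℝ) (hk : k ≠ 0) (l : ℂ) (hl : l ≠ 0)
    (hden : Complex.I * (ω : ℂ) + (ε : ℂ) * (κ₀ : ℂ) * (l ^ 2 - (k : ℂ) ^ 2) ≠ 0)
    (hP : -(ε : ℂ) ^ 2 * (κ₀ : ℂ) * (ν₀ : ℂ) * l ^ 6
      + (-Complex.I * (ε : ℂ) * (ω : ℂ) * ((κ₀ : ℂ) + (ν₀ : ℂ))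
          + 3 * (ν₀ : ℂ) * (κ₀ : ℂ) * (ε : ℂ) ^ 2 * (k : ℂ) ^ 2) * l ^ 4
      + (((ω : ℂ) ^ 2 - (Real.sin γ : ℂ) ^ 2)
          + 2 * Complex.I * (ε : ℂ) * (ω : ℂ) * ((κ₀ : ℂ) + (ν₀ : ℂ)) * (k : ℂ) ^ 2
          - 3 * (ν₀ : ℂ) * (κ₀ : ℂ) * (ε : ℂ) ^ 2 * (k : ℂ) ^ 4) * l ^ 2
      - 2 * Complex.I * l * (k : ℂ) * (Real.sin γ : ℂ) * (Real.cos γ : ℂ)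
      + (k : ℂ) ^ 2 * ((Real.cos γ : ℂ) ^ 2 - (ω : ℂ) ^ 2
          - Complex.I * (ε : ℂ) * (ω : ℂ) * ((ν₀ : ℂ) + (κ₀ : ℂ)) * (k : ℂ) ^ 2
          + (ν₀ : ℂ) * (κ₀ : ℂ) * (ε : ℂ) ^ 2 * (k : ℂ) ^ 4) = 0) :
    let U : ℂ := 1
    let W : ℂ := Complex.I * (k : ℂ) / l
    let B : ℂ := (l * (Real.sin γ : ℂ) + Complex.I * (k : ℂ) * (Real.cos γ : ℂ)) /
      (l * (Complex.I * (ω : ℂ) - (ε : ℂ) * (κ₀ : ℂ) * ((k : ℂ) ^ 2 - l ^ 2)))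
    let P₄ : ℂ := (1 / (Complex.I * (k : ℂ))) *
      (Complex.I * (ω : ℂ) + (ε : ℂ) * (ν₀ : ℂ) * (l ^ 2 - (k : ℂ) ^ 2)
        + (Real.sin γ : ℂ) * ((Real.sin γ : ℂ) + (Complex.I * (k : ℂ) / l) * (Real.cos γ : ℂ)) /
          (Complex.I * (ω : ℂ) + (ε : ℂ) * (κ₀ : ℂ) * (l ^ 2 - (k : ℂ) ^ 2)))
    ((-Complex.I * (ω : ℂ) - (ε : ℂ) * (ν₀ : ℂ) * (l ^ 2 - (k : ℂ) ^ 2)) * U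
      - (Real.sin γ : ℂ) * B + Complex.I * (k : ℂ) * P₄ = 0) ∧
    ((-Complex.I * (ω : ℂ) - (ε : ℂ) * (ν₀ : ℂ) * (l ^ 2 - (k : ℂ) ^ 2)) * W
      - (Real.cos γ : ℂ) * B - l * P₄ = 0) ∧
    ((-Complex.I * (ω : ℂ) - (ε : ℂ) * (κ₀ : ℂ) * (l ^ 2 - (k : ℂ) ^ 2)) * B
      + (Real.sin γ : ℂ) * U + (Real.cos γ : ℂ) * W = 0) ∧
    (Complex.I * (k : ℂ) * U - l * W = 0) := by
  intro U W B P₄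
  have hdet : (l ^ 2 - (k : ℂ) ^ 2) *
      ((I * (ω : ℂ) + (ε : ℂ) * (ν₀ : ℂ) * (l ^ 2 - (k : ℂ) ^ 2)) *
        (I * (ω : ℂ) + (ε : ℂ) * (κ₀ : ℂ) * (l ^ 2 - (k : ℂ) ^ 2)))
      + (l * (Real.sin γ : ℂ) + I * (k : ℂ) * (Real.cos γ : ℂ)) ^ 2 = 0 := by
    linear_combination -hP + ((l ^ 2 - (k : ℂ) ^ 2) * (ω : ℂ) ^ 2
      + (k : ℂ) ^ 2 * (Real.cos γ : ℂ) ^ 2) * I_sq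
  have hneg (a : ℂ) : -I * (ω : ℂ) - a * (l ^ 2 - (k : ℂ) ^ 2)
      = -(I * (ω : ℂ) + a * (l ^ 2 - (k : ℂ) ^ 2)) := by ring
  have hsub : I * (ω : ℂ) - (ε : ℂ) * (κ₀ : ℂ) * ((k : ℂ) ^ 2 - l ^ 2)
      = I * (ω : ℂ) + (ε : ℂ) * (κ₀ : ℂ) * (l ^ 2 - (k : ℂ) ^ 2) := by ring
  simp only [U, W, B, P₄, hneg, hsub]
  exact symbol_kernel (ofReal_ne_zero.mpr hk) hl hden hdet
end
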